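/- For a chordal (decomposable) graph (V,B), every positive definite V × V matrix Ω supported on B can be written as Ω = Δ_{11} + Γ_{21}^T Δ_{22} Γ_{21}, where Δ_{11}, Δ_{22} are diagonal matrices with positive diagonal entries (indexed by V and by the non-singleton cliques C_2 of (V,B) respectively) and Γ_{21} ∈ ℝ^{C_2 × V} has Γ_{21}[h,v] = 0 unless v ∈ h. -/

import Mathlib

open Matrix BigOperators

def SupportedOn {V : Type} (E : V → V → Prop) (Λ : Matrix V V ℝ) : Prop :=
  ∀ u v, ¬ E u v → Λ u v = 0

def Acyclic {V : Type} (E : V → V → Prop) : Prop :=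
  ∀ v, ¬ Relation.TransGen E v v

def cycAdj (p : ℕ) (i j : Fin p) : Prop :=
  (i.1 + 1) % p = j.1 ∨ (j.1 + 1) % p = i.1

structure Trek {V : Type} (E : V → V → Prop) (u v : V) where
  left : List V
  right : List V
  left_ne : left ≠ []
  right_ne : right ≠ []
  top_eq : left.head left_ne = right.head right_ne
  chain_left : List.Chain' E left
  chain_right : List.Chain' E right
  last_left : left.getLast left_ne = u
  last_right : right.getLast right_ne = v

def Trek.top {V : Type} {E : V → V → Prop} {u v : V} (τ : Trek E u v) : V :=
  τ.left.head τ.left_ne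

def edgeProd {V : Type} (Λ : Matrix V V ℝ) (l : List V) : ℝ :=
  ((l.zip l.tail).map fun p => Λ p.1 p.2).prod

def Trek.mono {V : Type} {E : V → V → Prop} {u v : V} (Λ Ω : Matrix V V ℝ)
    (τ : Trek E u v) : ℝ :=
  Ω τ.top τ.top * edgeProd Λ τ.left * edgeProd Λ τ.right

structure TrekSystem {V : Type} (E : V → V → Prop) {n : ℕ} (x y : Fin n → V) where
  perm : Equiv.Perm (Fin n)
  trek : ∀ i, Trek E (x i) (y (perm i))

def TrekSystem.NoSided {V : Type} {E : V → V → Prop} {n : ℕ} {x y : Fin n → V}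
    (S : TrekSystem E x y) : Prop :=
  ∀ i j, i ≠ j →
    (∀ a : V, ¬(a ∈ (S.trek i).left ∧ a ∈ (S.trek j).left)) ∧
    (∀ a : V, ¬(a ∈ (S.trek i).right ∧ a ∈ (S.trek j).right))

structure DWalk {U : Type} (E : U → U → Prop) (u v : U) where
  steps : List (Bool × U × U)
  ne : steps ≠ []
  first_eq : (steps.head ne).2.1 = u
  last_eq : (steps.getLast ne).2.2 = v
  edge : ∀ s ∈ steps, (s.1 = true → E s.2.1 s.2.2) ∧ (s.1 = false → E s.2.2 s.2.1)
  chain : List.Chain' (fun s t : Bool × U × U => s.2.2 = t.2.1) steps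

def stepPairOK {U : Type} (A : Set U) (s t : Bool × U × U) : Prop :=
  ((s.1 = true ∧ t.1 = false) → s.2.2 ∈ A) ∧ (¬(s.1 = true ∧ t.1 = false) → s.2.2 ∉ A)

def DWalk.DConn {U : Type} {E : U → U → Prop} {u v : U} (A : Set U)
    (w : DWalk E u v) : Prop :=
  List.Chain' (stepPairOK A) w.steps

def topOf {U : Type} : List (Bool × U × U) → U → U
  | [], u => u
  | (d, a, _b) :: rest, _ => if d then a else topOf rest _b

def DWalk.top {U : Type} {E : U → U → Prop} {u v : U} (w : DWalk E u v) : U :=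
  topOf w.steps u

def TopsA {U : Type} (E : U → U → Prop) (A : Set U) (u v : U) : Set U :=
  {t | ∃ w : DWalk E u v, w.DConn A ∧ w.top = t}

def anAvoid {U : Type} (E : U → U → Prop) (A : Set U) (x : U) : Set U :=
  {u | u ∉ A ∧ Relation.ReflTransGen (fun a b => E a b ∧ a ∉ A ∧ b ∉ A) u x}

def EA {U : Type} (E : U → U → Prop) (A : Set U) (n1 n2 : U) : Set (U × U) :=
  {e | E e.1 e.2 ∧ e.1 ∈ TopsA E A n1 n2 ∧ e.2 ∈ anAvoid E A n1 ∧ e.2 ∉ TopsA E A n1 n2}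

def IsProperPath {U : Type} (E : U → U → Prop) (A : Set U) (l : List U) : Prop :=
  l ≠ [] ∧ List.Chain' (fun a b => E a b ∧ a ∉ A) l

def DigraphCov {U : Type} [Fintype U] [DecidableEq U] (E : U → U → Prop) :
    Set (Matrix U U ℝ) :=
  {S | ∃ Λ Ω : Matrix U U ℝ, SupportedOn E Λ ∧ Ω.IsDiag ∧ (∀ u, 0 < Ω u u) ∧
        S = ((1 - Λ)⁻¹)ᵀ * Ω * (1 - Λ)⁻¹}

def BSupported {V : Type} (B : SimpleGraph V) (Ω : Matrix V V ℝ) : Prop :=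
  ∀ u v, u ≠ v → ¬ B.Adj u v → Ω u v = 0

def MixedCov {V : Type} [Fintype V] [DecidableEq V] (D : V → V → Prop)
    (B : SimpleGraph V) : Set (Matrix V V ℝ) :=
  {S | ∃ Λ Ω : Matrix V V ℝ, SupportedOn D Λ ∧ Ω.PosDef ∧ BSupported B Ω ∧
        S = ((1 - Λ)⁻¹)ᵀ * Ω * (1 - Λ)⁻¹}

def StrictlyGaussianCausal {V : Type} [Fintype V] [DecidableEq V]
    (D : V → V → Prop) (B : SimpleGraph V) : Prop :=
  ∃ (U : Type) (iF : Fintype U) (iD : DecidableEq U) (ι : V ↪ U) (E : U → U → Prop),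
    Acyclic E ∧
      (fun S : Matrix U U ℝ => S.submatrix ι ι) '' (@DigraphCov U iF iD E) = MixedCov D B

def Chordal {V : Type} (B : SimpleGraph V) : Prop :=
  ∀ n : ℕ, 4 ≤ n → ∀ f : ZMod n → V, Function.Injective f →
    (∀ i, B.Adj (f i) (f (i + 1))) →
    ∃ i j : ZMod n, j ≠ i + 1 ∧ i ≠ j + 1 ∧ i ≠ j ∧ B.Adj (f i) (f j)

def ChainGraph {V : Type} (D : V → V → Prop) (B : SimpleGraph V) : Prop :=
  ¬ ∃ u v, D u v ∧ Relation.ReflTransGen (fun a b => D a b ∨ B.Adj a b) v u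


def CliqueType {V : Type} [DecidableEq V] (B : SimpleGraph V) : Type :=
  {s : Finset V // B.IsClique ↑s ∧ 2 ≤ s.card}

noncomputable instance {V : Type} [Fintype V] [DecidableEq V] (B : SimpleGraph V) :
    Fintype (CliqueType B) := by
  classical
  unfold CliqueType
  infer_instance

instance {V : Type} [DecidableEq V] (B : SimpleGraph V) :
    DecidableEq (CliqueType B) := by
  unfold CliqueType
  infer_instance


theorem induced_cycle_aux {V : Type} (B : SimpleGraph V) (hch : Chordal B)
    (C : Set V) (v a b ca cb : V) (hab : a ≠ b) (hnab : ¬ B.Adj a b)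
    (hva : B.Adj v a) (hvb : B.Adj v b) (hvC : v ∉ C) (hCv : ∀ c ∈ C, ¬ B.Adj v c)
    (hca : ca ∈ C) (hcb : cb ∈ C) (haca : B.Adj a ca) (hbcb : B.Adj b cb)
    (hreach : Relation.ReflTransGen (fun x y => B.Adj x y ∧ x ∈ C ∧ y ∈ C) ca cb) : False := by
  let W : Set V := {x | x ∈ C ∨ x = a ∨ x = b}
  let H : SimpleGraph V :=
    { Adj := fun x y => B.Adj x y ∧ x ∈ W ∧ y ∈ W
      symm := ⟨fun x y h => ⟨h.1.symm, h.2.2, h.2.1⟩⟩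
      loopless := ⟨fun x h => B.loopless.irrefl x h.1⟩ }
  have hCW : ∀ x ∈ C, x ∈ W := fun x hx => Or.inl hx
  have haW : a ∈ W := Or.inr (Or.inl rfl)
  have hbW : b ∈ W := Or.inr (Or.inr rfl)
  have h1 : H.Reachable ca cb := by
    rw [SimpleGraph.reachable_iff_reflTransGen]
    exact hreach.lift id fun x y h => ⟨h.1, hCW x h.2.1, hCW y h.2.2⟩
  have h2 : H.Adj a ca := ⟨haca, haW, hCW _ hca⟩
  have h3 : H.Adj cb b := ⟨hbcb.symm, hCW _ hcb, hbW⟩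
  have hr : H.Reachable a b := (h2.reachable.trans h1).trans h3.reachable
  have hnH : ¬ H.Adj a b := fun h => hnab h.1
  have hL2 := hr.one_lt_dist_of_ne_of_not_adj hab hnH
  obtain ⟨p, hp⟩ := hr.exists_walk_length_eq_dist
  rw [← hp] at hL2
  set L := p.length with hL
  have hadj : ∀ i, i < L → H.Adj (p.getVert i) (p.getVert (i+1)) :=
    fun i hi => p.adj_getVert_succ hi
  have hW : ∀ i, i ≤ L → p.getVert i ∈ W := by
    intro i hi
    rcases Nat.lt_or_ge i L with h | h
    · exact (hadj i h).2.1
    · rw [p.getVert_of_length_le h]; exact hbW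
  have hd1 : ∀ i, i ≤ L → H.dist a (p.getVert i) ≤ i := by
    intro i hi
    have := SimpleGraph.dist_le (p.take i)
    rw [SimpleGraph.Walk.take_length] at this
    omega
  have hd2 : ∀ i, i ≤ L → H.dist (p.getVert i) b ≤ L - i := by
    intro i hi
    have := SimpleGraph.dist_le (p.drop i)
    rw [SimpleGraph.Walk.drop_length] at this
    omega
  have hra : ∀ i, H.Reachable a (p.getVert i) := fun i => ⟨p.take i⟩
  have hd : ∀ i, i ≤ L → H.dist a (p.getVert i) = i := by
    intro i hi
    have h1 := hd1 i hi
    have h2 := hd2 i hi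
    have h3 := (hra i).dist_triangle_left b
    omega
  have hinj : ∀ i j, i ≤ L → j ≤ L → p.getVert i = p.getVert j → i = j := by
    intro i j hi hj h
    rw [← hd i hi, ← hd j hj, h]
  have hcons : ∀ i j, i ≤ L → j ≤ L → B.Adj (p.getVert i) (p.getVert j) →
      i ≤ j + 1 := by
    intro i j hi hj h
    have hH : H.Adj (p.getVert j) (p.getVert i) := ⟨h.symm, hW j hj, hW i hi⟩
    have h3 := (hra j).dist_triangle_left (p.getVert i)
    rw [hd i hi, hd j hj, SimpleGraph.dist_eq_one_iff_adj.mpr hH] at h3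
    exact h3
  have hvp : ∀ i, i ≤ L → v ≠ p.getVert i := by
    intro i hi h
    rcases hW i hi with h' | h' | h'
    · exact hvC (h ▸ h')
    · exact hva.ne (h.trans h')
    · exact hvb.ne (h.trans h')
  have hvadj : ∀ i, i ≤ L → B.Adj v (p.getVert i) → i = 0 ∨ i = L := by
    intro i hi h
    rcases hW i hi with h' | h' | h'
    · exact absurd h (hCv _ h')
    · left; exact hinj i 0 hi (by omega) (by rw [h', p.getVert_zero])
    · right; exact hinj i L hi le_rfl (by rw [h', p.getVert_length])
  let f : ZMod (L + 2) → V := fun i => if i.val ≤ L then p.getVert i.val else v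
  have hlt : ∀ i : ZMod (L+2), i.val < L + 2 := fun i => ZMod.val_lt i
  have hval : ∀ i j : ZMod (L+2), j.val = i.val + 1 → j = i + 1 := by
    intro i j h
    rw [← ZMod.natCast_zmod_val j, h]; push_cast; rw [ZMod.natCast_zmod_val]
  have hval0 : ∀ i j : ZMod (L+2), j.val = 0 → i.val = L + 1 → j = i + 1 := by
    intro i j h h'
    rw [← ZMod.natCast_zmod_val j, ← ZMod.natCast_zmod_val i, h, h']
    have := ZMod.natCast_self (L + 2)
    push_cast at this ⊢
    rw [← this]; ring
  have hfinj : Function.Injective f := by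
    intro i j h
    apply ZMod.val_injective
    have hi := hlt i
    have hj := hlt j
    simp only [f] at h
    split_ifs at h with h1 h2 h2
    · exact hinj _ _ h1 h2 h
    · exact absurd h.symm (hvp _ h1)
    · exact absurd h (hvp _ h2)
    · omega
  obtain ⟨i, j, hj, hi, hij, hA⟩ := hch (L + 2) (by omega) f hfinj (by
    intro i
    have hi := hlt i
    rcases Nat.lt_or_ge i.val (L + 1) with h | h
    · have hs : (i + 1).val = i.val + 1 := by
        have : ((i.val + 1 : ℕ) : ZMod (L+2)).val = i.val + 1 := ZMod.val_cast_of_lt (by omega)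
        rw [← this]; push_cast; rw [ZMod.natCast_zmod_val]
      simp only [f, hs]
      rw [if_pos (by omega)]
      split_ifs with h2
      · exact (hadj _ (by omega)).1
      · have : i.val = L := by omega
        rw [this, hL, p.getVert_length]; exact hvb.symm
    · have hs : (i + 1) = 0 := (hval0 i 0 ZMod.val_zero (by omega)).symm
      simp only [f, hs]
      rw [if_neg (by omega), ZMod.val_zero, if_pos (by omega), p.getVert_zero]
      exact hva)
  have hi' := hlt i
  have hj' := hlt j
  have n1 : j.val ≠ i.val + 1 := fun h => hj (hval _ _ h)
  have n2 : i.val ≠ j.val + 1 := fun h => hi (hval _ _ h)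
  have n3 : i.val ≠ j.val := fun h => hij (ZMod.val_injective _ h)
  have n4 : ¬ (j.val = 0 ∧ i.val = L + 1) := fun h => hj (hval0 _ _ h.1 h.2)
  have n5 : ¬ (i.val = 0 ∧ j.val = L + 1) := fun h => hi (hval0 _ _ h.1 h.2)
  simp only [f] at hA
  split_ifs at hA with h1 h2 h2
  · have := hcons _ _ h1 h2 hA
    have := hcons _ _ h2 h1 hA.symm
    omega
  · have := hvadj _ h1 hA.symm
    omega
  · have := hvadj _ h2 hA
    omega
  · omega

theorem simplicial_aux {V : Type} [DecidableEq V] (B : SimpleGraph V) (hch : Chordal B) :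
    ∀ (n : ℕ) (S : Finset V), S.card = n → ∀ v ∈ S, (∃ u ∈ S, u ≠ v ∧ ¬ B.Adj v u) →
      ∃ w ∈ S, w ≠ v ∧ ¬ B.Adj v w ∧
        ∀ x ∈ S, ∀ y ∈ S, B.Adj w x → B.Adj w y → x ≠ y → B.Adj x y := by
  classical
  intro n
  induction n using Nat.strong_induction_on with
  | _ n ih =>
  intro S hS v hv ⟨c0, hc0, hc0v, hc0a⟩
  let R : Set V := {x | x ∈ S ∧ x ≠ v ∧ ¬ B.Adj v x}
  let C : Set V := {x | Relation.ReflTransGen (fun x y => B.Adj x y ∧ x ∈ R ∧ y ∈ R) c0 x}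
  have hc0C : c0 ∈ C := Relation.ReflTransGen.refl
  have hCR : ∀ x ∈ C, x ∈ R := by
    intro x hx
    rcases Relation.ReflTransGen.cases_tail hx with h | ⟨y, _, h⟩
    · rw [h]; exact ⟨hc0, hc0v, hc0a⟩
    · exact h.2.2
  have hCext : ∀ x ∈ C, ∀ y ∈ R, B.Adj x y → y ∈ C := fun x hx y hy h =>
    Relation.ReflTransGen.tail hx ⟨h, hCR x hx, hy⟩
  have hCreach0 : ∀ x ∈ C,
      Relation.ReflTransGen (fun x y => B.Adj x y ∧ x ∈ C ∧ y ∈ C) c0 x := by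
    intro x hx
    induction hx with
    | refl => exact Relation.ReflTransGen.refl
    | tail h1 h2 ih2 =>
      exact ih2.tail ⟨h2.1, h1, hCext _ h1 _ h2.2.2 h2.1⟩
  have hCreach : ∀ x ∈ C, ∀ y ∈ C,
      Relation.ReflTransGen (fun x y => B.Adj x y ∧ x ∈ C ∧ y ∈ C) x y := by
    intro x hx y hy
    refine Relation.ReflTransGen.trans ?_ (hCreach0 y hy)
    induction hCreach0 x hx with
    | refl => exact Relation.ReflTransGen.refl
    | tail h1 h2 ih2 => exact Relation.ReflTransGen.head ⟨h2.1.symm, h2.2.2, h2.2.1⟩ (ih2 h2.2.1)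
  let S' : Finset V := S.filter fun x => x ∈ C ∨ ∃ c ∈ C, B.Adj x c
  have hvS' : v ∉ S' := by
    intro h
    rcases (Finset.mem_filter.mp h).2 with h | ⟨c, hc, h⟩
    · exact (hCR v h).2.1 rfl
    · exact (hCR c hc).2.2 h
  have hCS' : ∀ x ∈ C, x ∈ S' := fun x hx => Finset.mem_filter.mpr ⟨(hCR x hx).1, Or.inl hx⟩
  have hsub : S' ⊆ S := Finset.filter_subset _ _
  have hcard : S'.card < n := by
    rw [← hS]
    exact Finset.card_lt_card ((Finset.ssubset_iff_of_subset hsub).mpr ⟨v, hv, hvS'⟩)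
  have hT : ∀ a ∈ S', a ∉ C → B.Adj v a ∧ ∃ c ∈ C, B.Adj a c := by
    intro a ha haC
    rcases (Finset.mem_filter.mp ha).2 with h | ⟨c, hc, h⟩
    · exact absurd h haC
    · refine ⟨?_, c, hc, h⟩
      by_contra hna
      exact haC (hCext c hc a ⟨hsub ha, fun e => hvS' (e ▸ ha), hna⟩ h.symm)
  have hTclique : ∀ a ∈ S', a ∉ C → ∀ b ∈ S', b ∉ C → a ≠ b → B.Adj a b := by
    intro a ha haC b hb hbC hab
    by_contra hn
    obtain ⟨hva, ca, hca, haca⟩ := hT a ha haC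
    obtain ⟨hvb, cb, hcb, hbcb⟩ := hT b hb hbC
    exact induced_cycle_aux B hch C v a b ca cb hab hn hva hvb
      (fun h => (hCR v h).2.1 rfl) (fun c hc => (hCR c hc).2.2) hca hcb haca hbcb
      (hCreach ca hca cb hcb)
  have key : ∃ w ∈ C, ∀ x ∈ S', ∀ y ∈ S', B.Adj w x → B.Adj w y → x ≠ y → B.Adj x y := by
    by_cases hcomp : ∀ x ∈ S', ∀ y ∈ S', x ≠ y → B.Adj x y
    · exact ⟨c0, hc0C, fun x hx y hy _ _ h => hcomp x hx y hy h⟩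
    · push Not at hcomp
      obtain ⟨x, hx, y, hy, hxy, hna⟩ := hcomp
      obtain ⟨w, hw, hwx, hwa, hws⟩ := ih _ hcard S' rfl x hx ⟨y, hy, hxy.symm, hna⟩
      by_cases hwC : w ∈ C
      · exact ⟨w, hwC, hws⟩
      · obtain ⟨w', hw', hww, hwa', hws'⟩ := ih _ hcard S' rfl w hw
          ⟨x, hx, hwx.symm, fun h => hwa h.symm⟩
        by_cases hwC' : w' ∈ C
        · exact ⟨w', hwC', hws'⟩
        · exact absurd (hTclique w hw hwC w' hw' hwC' hww.symm) hwa'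
  obtain ⟨w, hwC, hws⟩ := key
  have hnb : ∀ x ∈ S, B.Adj w x → x ∈ S' := fun x hx h =>
    Finset.mem_filter.mpr ⟨hx, Or.inr ⟨w, hwC, h.symm⟩⟩
  exact ⟨w, (hCR w hwC).1, (hCR w hwC).2.1, (hCR w hwC).2.2,
    fun x hx y hy h1 h2 h3 => hws x (hnb x hx h1) y (hnb y hy h2) h1 h2 h3⟩

theorem exists_simplicial {V : Type} [DecidableEq V] (B : SimpleGraph V) (hch : Chordal B)
    (S : Finset V) (hS : S.Nonempty) :
    ∃ w ∈ S, ∀ x ∈ S, ∀ y ∈ S, B.Adj w x → B.Adj w y → x ≠ y → B.Adj x y := by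
  by_cases hcomp : ∀ x ∈ S, ∀ y ∈ S, x ≠ y → B.Adj x y
  · obtain ⟨w, hw⟩ := hS
    exact ⟨w, hw, fun x hx y hy _ _ h => hcomp x hx y hy h⟩
  · push Not at hcomp
    obtain ⟨x, hx, y, hy, hxy, hna⟩ := hcomp
    obtain ⟨w, hw, _, _, h⟩ := simplicial_aux B hch _ S rfl x hx ⟨y, hy, hxy.symm, hna⟩
    exact ⟨w, hw, h⟩

theorem exists_pos_shift {V : Type} [Fintype V] [DecidableEq V] (Ω : Matrix V V ℝ)
    (hPD : Ω.PosDef) : ∃ ε : ℝ, 0 < ε ∧ (Ω - ε • (1 : Matrix V V ℝ)).PosSemidef := by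
  rcases isEmpty_or_nonempty V with hV | hV
  · refine ⟨1, one_pos, ?_⟩
    rw [Subsingleton.elim (Ω - (1:ℝ) • (1 : Matrix V V ℝ)) 0]
    exact Matrix.PosSemidef.zero
  · obtain ⟨i, hi⟩ := Finite.exists_min hPD.1.eigenvalues
    refine ⟨hPD.1.eigenvalues i, hPD.eigenvalues_pos i, ?_⟩
    rw [Matrix.posSemidef_iff_isHermitian_and_spectrum_nonneg]
    refine ⟨hPD.1.sub (Matrix.IsHermitian.ext fun a b => by simp [Matrix.one_apply, eq_comm]), ?_⟩
    intro x hx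
    rw [← Algebra.algebraMap_eq_smul_one, ← spectrum.sub_singleton_eq,
      hPD.1.spectrum_real_eq_range_eigenvalues] at hx
    obtain ⟨_, ⟨j, rfl⟩, _, rfl, rfl⟩ := hx
    simpa using hi j

theorem clique_decomp {V : Type} [Fintype V] [DecidableEq V] (B : SimpleGraph V)
    (hch : Chordal B) : ∀ (n : ℕ) (S : Finset V), S.card = n → ∀ Ω : Matrix V V ℝ,
      Ω.PosSemidef → BSupported B Ω → (∀ u v, u ∉ S → Ω u v = 0) →
      ∃ x : Finset V → V → ℝ, (∀ K v, v ∉ K → x K v = 0) ∧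
        (∀ K : Finset V, ¬ (B.IsClique (K : Set V) ∧ K ⊆ S) → x K = 0) ∧
        ∀ u v, Ω u v = ∑ K, x K u * x K v := by
  intro n
  induction n with
  | zero =>
    intro S hS Ω _ _ h0
    rw [Finset.card_eq_zero] at hS
    subst hS
    exact ⟨fun _ _ => 0, by simp, fun _ _ => rfl, fun u v => by simp [h0]⟩
  | succ n ih =>
    intro S hS Ω hP hB h0
    obtain ⟨w, hw, hws⟩ := exists_simplicial B hch S (Finset.card_pos.mp (by omega))
    have hsym : ∀ u v, Ω u v = Ω v u := fun u v => by
      have := hP.1.apply u v; simpa using this.symm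
    have h0' : ∀ u v, v ∉ S → Ω u v = 0 := fun u v h => by rw [hsym]; exact h0 v u h
    have hcol : Ω w w = 0 → ∀ u, Ω u w = 0 := by
      intro h u
      have := (hP.dotProduct_mulVec_zero_iff (Pi.single w 1)).mp (by simp [h])
      have := congrFun this u
      simpa using this
    have hww : 0 ≤ Ω w w := hP.diag_nonneg
    let y : V → ℝ := fun u => Ω u w / Real.sqrt (Ω w w)
    have hyy : ∀ u v, y u * y v = Ω u w * Ω v w / Ω w w := by
      intro u v
      simp only [y]
      rw [div_mul_div_comm, Real.mul_self_sqrt hww]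
    let Ω' : Matrix V V ℝ := Matrix.of fun u v => Ω u v - y u * y v
    have hwcol : ∀ u, Ω' u w = 0 := by
      intro u
      simp only [Ω', Matrix.of_apply, hyy]
      by_cases h : Ω w w = 0
      · simp [hcol h]
      · field_simp; ring
    have hsym' : ∀ u v, Ω' u v = Ω' v u := fun u v => by
      simp only [Ω', Matrix.of_apply]; rw [hsym u v]; ring
    classical
    let K0 : Finset V := insert w (S.filter fun u => B.Adj w u)
    have hK0S : K0 ⊆ S := by
      intro u hu
      rcases Finset.mem_insert.mp hu with h | h
      · exact h ▸ hw
      · exact (Finset.mem_filter.mp h).1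
    have hyK : ∀ u, u ∉ K0 → y u = 0 := by
      intro u hu
      have hu1 : u ≠ w := fun h => hu (h ▸ Finset.mem_insert_self _ _)
      have : Ω u w = 0 := by
        by_cases huS : u ∈ S
        · exact hB u w hu1 fun h => hu (Finset.mem_insert_of_mem
            (Finset.mem_filter.mpr ⟨huS, h.symm⟩))
        · exact h0 u w huS
      simp [y, this]
    have hK0c : B.IsClique (K0 : Set V) := by
      intro a ha b hb hab
      rcases Finset.mem_insert.mp (Finset.mem_coe.mp ha) with h | h <;>
      rcases Finset.mem_insert.mp (Finset.mem_coe.mp hb) with h' | h'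
      · exact absurd (h.trans h'.symm) hab
      · rw [h]; exact (Finset.mem_filter.mp h').2
      · rw [h']; exact (Finset.mem_filter.mp h).2.symm
      · exact hws a (Finset.mem_filter.mp h).1 b (Finset.mem_filter.mp h').1
          (Finset.mem_filter.mp h).2 (Finset.mem_filter.mp h').2 hab
    have hB' : BSupported B Ω' := by
      intro u v huv hn
      simp only [Ω', Matrix.of_apply]
      rw [hB u v huv hn]
      by_cases hu : u ∈ K0
      · by_cases hv : v ∈ K0
        · exact absurd (hK0c hu hv huv) hn
        · simp [hyK v hv]
      · simp [hyK u hu]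
    have h0'' : ∀ u v, u ∉ S.erase w → Ω' u v = 0 := by
      intro u v hu
      by_cases huw : u = w
      · rw [huw, hsym', hwcol]
      · have huS : u ∉ S := fun h => hu (Finset.mem_erase.mpr ⟨huw, h⟩)
        simp only [Ω', Matrix.of_apply]
        rw [h0 u v huS, hyK u fun h => huS (hK0S h)]
        ring
    have hP' : Ω'.PosSemidef := by
      by_cases h : Ω w w = 0
      · have : Ω' = Ω := by
          ext u v; simp [Ω', hyy, hcol h]
        rw [this]; exact hP
      · let A : Matrix V V ℝ := Matrix.of fun i j => (if i = j then 1 else 0) -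
          (if i = w then Ω j w / Ω w w else 0)
        have : Ω' = Aᴴ * Ω * A := by
          have hΩA : ∀ u v, (Ω * A) u v = Ω' u v := by
            intro u v
            simp only [Matrix.mul_apply, A, Matrix.of_apply, mul_sub, Finset.sum_sub_distrib, mul_ite, mul_one,
              mul_zero, Finset.sum_ite_eq', Finset.mem_univ, if_true, Ω', hyy, Matrix.of_apply]
            ring
          ext u v
          rw [Matrix.mul_assoc, Matrix.mul_apply]
          simp only [hΩA, Matrix.conjTranspose_apply, star_trivial, A, Matrix.of_apply, sub_mul,
            Finset.sum_sub_distrib, ite_mul, one_mul, zero_mul]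
          simp [hsym' w v, hwcol]
        rw [this]
        exact hP.conjTranspose_mul_mul_same A
    obtain ⟨x, hx1, hx2, hx3⟩ := ih (S.erase w) (by rw [Finset.card_erase_of_mem hw]; omega)
      Ω' hP' hB' h0''
    have hwK0 : w ∈ K0 := Finset.mem_insert_self _ _
    have hxK0 : x K0 = 0 := hx2 K0 fun h => by
      have := h.2 hwK0
      simp at this
    refine ⟨Function.update x K0 y, ?_, ?_, ?_⟩
    · intro K v hv
      by_cases hK : K = K0
      · subst hK; rw [Function.update_self]; exact hyK v hv
      · rw [Function.update_of_ne hK]; exact hx1 K v hv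
    · intro K hK
      by_cases hK' : K = K0
      · exact absurd ⟨hK' ▸ hK0c, hK' ▸ hK0S⟩ hK
      · rw [Function.update_of_ne hK']
        exact hx2 K fun h => hK ⟨h.1, h.2.trans (Finset.erase_subset _ _)⟩
    · intro u v
      have e : Ω u v = Ω' u v + y u * y v := by simp [Ω']
      rw [e, hx3]
      rw [← Finset.add_sum_erase _ _ (Finset.mem_univ K0),
        ← Finset.add_sum_erase _ (fun K => Function.update x K0 y K u * Function.update x K0 y K v) (Finset.mem_univ K0)]
      rw [hxK0, Function.update_self]
      have e3 : ∀ K ∈ Finset.univ.erase K0,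
          Function.update x K0 y K u * Function.update x K0 y K v = x K u * x K v := by
        intro K hK
        rw [Function.update_of_ne (Finset.ne_of_mem_erase hK)]
      rw [Finset.sum_congr rfl e3]
      simp only [Pi.zero_apply]
      ring

open scoped Classical in
theorem stmt8 {V : Type} [Fintype V] [DecidableEq V] (B : SimpleGraph V)
    (hch : Chordal B) (Ω : Matrix V V ℝ) (hPD : Ω.PosDef) (hsupp : BSupported B Ω) :
    ∃ (Δ11 : Matrix V V ℝ) (Δ22 : Matrix (CliqueType B) (CliqueType B) ℝ)
      (Γ21 : Matrix (CliqueType B) V ℝ),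
      Δ11.IsDiag ∧ (∀ v, 0 < Δ11 v v) ∧ Δ22.IsDiag ∧ (∀ h, 0 < Δ22 h h) ∧
      (∀ h v, v ∉ h.1 → Γ21 h v = 0) ∧
      Ω = Δ11 + Γ21ᵀ * Δ22 * Γ21 := by
  obtain ⟨ε, hε, hP⟩ := exists_pos_shift Ω hPD
  obtain ⟨x, hx1, hx2, hx3⟩ := clique_decomp B hch _ Finset.univ rfl _ hP (by
    intro u v huv hn
    simp [hsupp u v huv hn, huv]) (by simp)
  let small : V → V → ℝ := fun u v =>
    ∑ K ∈ Finset.univ.filter (fun K : Finset V => ¬ 2 ≤ K.card), x K u * x K v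
  have hsmall : ∀ u v, u ≠ v → small u v = 0 := by
    intro u v huv
    refine Finset.sum_eq_zero fun K hK => ?_
    have hK := (Finset.mem_filter.mp hK).2
    by_cases hu : u ∈ K
    · by_cases hv : v ∈ K
      · exact absurd (Finset.one_lt_card.mpr ⟨u, hu, v, hv, huv⟩) hK
      · simp [hx1 K v hv]
    · simp [hx1 K u hu]
  have hsmall0 : ∀ u, 0 ≤ small u u := fun u => Finset.sum_nonneg fun K _ => mul_self_nonneg _
  refine ⟨Matrix.of fun u v => ε * (1 : Matrix V V ℝ) u v + small u v, 1,
    Matrix.of fun h v => x h.1 v,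
    ?_, ?_, Matrix.isDiag_one, ?_, ?_, ?_⟩
  · intro u v huv
    simp [hsmall u v huv, huv]
  · intro v
    have := hsmall0 v
    simp only [Matrix.of_apply, Matrix.one_apply_eq]
    linarith
  · intro h; simp
  · intro h v hv; exact hx1 h.1 v hv
  · ext u v
    have e := hx3 u v
    have e2 : ∑ h : CliqueType B, x h.1 u * x h.1 v =
        ∑ K ∈ Finset.univ.filter (fun K : Finset V => 2 ≤ K.card), x K u * x K v := by
      refine Finset.sum_of_injOn (fun h : CliqueType B => h.1) ?_ ?_ ?_ ?_
      · intro a _ b _ h; exact Subtype.ext h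
      · intro a _; simpa using a.2.2
      · intro K hK hK'
        have hK := (Finset.mem_filter.mp hK).2
        rw [hx2 K fun h => hK' ⟨⟨K, h.1, hK⟩, Finset.mem_coe.mpr (Finset.mem_univ _), rfl⟩]
        simp
      · intro _ _; rfl
    rw [← Finset.sum_filter_add_sum_filter_not Finset.univ (fun K : Finset V => 2 ≤ K.card),
      ← e2] at e
    rw [Matrix.add_apply, Matrix.mul_one, Matrix.mul_apply]
    simp only [Matrix.sub_apply, Matrix.smul_apply, smul_eq_mul] at e
    simp only [Matrix.transpose_apply, Matrix.of_apply, small]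
    linarith
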